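/- arXiv:2212.03643 — 2 statements merged into one kernel-verified Lean document; each statement's English description precedes it below -/
import Mathlib

section
/- Let k be a field of characteristic 2, let V be a k-vector space of dimension i ≥ 1, and let u be a unipotent linear endomorphism of V acting as a single Jordan block of size i. Then the fixed space of the induced action of u on the exterior square Λ²(V) has dimension ⌊i/2⌋. -/
open TensorProduct

/-- The submodule of `W ⊗ W` spanned by the squares `x ⊗ x`.  The quotient by this
submodule is the exterior square `Λ²(W)` (in every characteristic), while in
characteristic `≠ 2` this submodule itself is the symmetric square `Sym²(W)`. -/
noncomputable def sqT (k W : Type*) [Field k] [AddCommGroup W] [Module k W] :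
    Submodule k (W ⊗[k] W) :=
  Submodule.span k {z | ∃ x : W, z = x ⊗ₜ[k] x}

/-- The endomorphism of the exterior square `Λ²(W) = (W ⊗ W)/⟨x ⊗ x⟩` induced by a linear
endomorphism `u` of `W`. -/
noncomputable def extSqMap {k W : Type*} [Field k] [AddCommGroup W] [Module k W]
    (u : W →ₗ[k] W) : ((W ⊗[k] W) ⧸ sqT k W) →ₗ[k] ((W ⊗[k] W) ⧸ sqT k W) :=
  Submodule.mapQ _ _ (TensorProduct.map u u)
    (Submodule.span_le.mpr (by
      rintro _ ⟨x, rfl⟩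
      simp only [SetLike.mem_coe, Submodule.mem_comap, TensorProduct.map_tmul]
      exact Submodule.subset_span ⟨u x, rfl⟩))

open Polynomial in
/-- The minimal polynomial of an element with nilpotency index `m` is `X ^ m`. -/
theorem minpoly_eq_X_pow_of_pow_eq_zero_iff {k A : Type*} [Field k] [Ring A] [Algebra k A]
    {s : A} {m : ℕ} (hs : ∀ j, s ^ j = 0 ↔ m ≤ j) : minpoly k s = X ^ m := by
  have hm : aeval s (X ^ m : k[X]) = 0 := by simp [hs]
  have hint : IsIntegral k s := ⟨X ^ m, monic_X_pow m, by simpa [← aeval_def] using hm⟩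
  obtain ⟨l, hl, hassoc⟩ := (dvd_prime_pow prime_X m).mp (minpoly.dvd k s hm)
  have heq := eq_of_monic_of_associated (minpoly.monic hint) (monic_X_pow l) hassoc
  have hml : m ≤ l := by
    have := minpoly.aeval k s
    rwa [heq, map_pow, aeval_X, hs] at this
  rw [heq, le_antisymm hl hml]

/-- An element with nilpotency index `m` generates a subalgebra of dimension `m`. -/
theorem finrank_adjoin_singleton_of_pow_eq_zero_iff {k A : Type*} [Field k] [CommRing A]
    [Algebra k A] {s : A} {m : ℕ} (hs : ∀ j, s ^ j = 0 ↔ m ≤ j) :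
    Module.finrank k (Algebra.adjoin k {s}) = m := by
  have hint : IsIntegral k s :=
    ⟨.X ^ m, Polynomial.monic_X_pow m, by simp [hs]⟩
  rw [(Algebra.adjoin.powerBasis hint).finrank, Algebra.adjoin.powerBasis_dim,
    minpoly_eq_X_pow_of_pow_eq_zero_iff hs, Polynomial.natDegree_X_pow]

section Involution

variable {k A : Type*} [Field k] [CommRing A] [Algebra k A]

/-- The span of the norms `x * σ x`. -/
def normSpan (σ : A →ₐ[k] A) : Submodule k A :=
  Submodule.span k (Set.range fun x => x * σ x)

variable {σ : A →ₐ[k] A} {n : A}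

/-- The ring `A` is generated by `1` and `n` over the subalgebra generated by the trace of `n`. -/
theorem exists_eq_add_mul_of_adjoin_eq_top (hn : Algebra.adjoin k {n} = ⊤)
    (hrel : (1 + n) * (1 + σ n) = 1) (x : A) :
    ∃ a ∈ Algebra.adjoin k {n + σ n}, ∃ b ∈ Algebra.adjoin k {n + σ n}, x = a + n * b := by
  set s := n + σ n with hs
  have hsS : s ∈ Algebra.adjoin k {s} := Algebra.self_mem_adjoin_singleton k s
  have hsq : n * n = s + n * s := by linear_combination -hrel - (1 + n) * hs
  have hx : x ∈ Algebra.adjoin k {n} := hn ▸ Algebra.mem_top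
  induction hx using Algebra.adjoin_induction with
  | mem x hx =>
    obtain rfl := Set.mem_singleton_iff.mp hx
    exact ⟨0, zero_mem _, 1, one_mem _, by ring⟩
  | algebraMap r => exact ⟨_, Subalgebra.algebraMap_mem _ r, 0, zero_mem _, by ring⟩
  | add x y _ _ hx hy =>
    obtain ⟨a, ha, b, hb, rfl⟩ := hx
    obtain ⟨c, hc, d, hd, rfl⟩ := hy
    exact ⟨_, add_mem ha hc, _, add_mem hb hd, by ring⟩
  | mul x y _ _ hx hy =>
    obtain ⟨a, ha, b, hb, rfl⟩ := hx
    obtain ⟨c, hc, d, hd, rfl⟩ := hy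
    refine ⟨a * c + s * (b * d), add_mem (mul_mem ha hc) (mul_mem hsS (mul_mem hb hd)),
      a * d + b * c + s * (b * d), add_mem (add_mem (mul_mem ha hd) (mul_mem hb hc))
        (mul_mem hsS (mul_mem hb hd)), ?_⟩
    linear_combination b * d * hsq

/-- If `σ` is an involution sending `1 + n` to its inverse, where `n` generates `A`, then the
norms span the subalgebra generated by the trace of `n`. -/
theorem normSpan_eq_adjoin (hσ : ∀ x, σ (σ x) = x) (hn : Algebra.adjoin k {n} = ⊤)
    (hrel : (1 + n) * (1 + σ n) = 1) :
    normSpan σ = Subalgebra.toSubmodule (Algebra.adjoin k {n + σ n}) := by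
  set s := n + σ n with hs
  have hnorm : n * σ n = - s := by linear_combination hrel + hs
  have hsS : s ∈ Algebra.adjoin k {s} := Algebra.self_mem_adjoin_singleton k s
  have hfix : ∀ a ∈ Algebra.adjoin k {s}, σ a = a := by
    have hle : Algebra.adjoin k {s} ≤ AlgHom.equalizer σ (AlgHom.id k A) :=
      Algebra.adjoin_le (by simp [hs, hσ, add_comm])
    exact fun a ha => hle ha
  apply le_antisymm
  · refine Submodule.span_le.mpr ?_
    rintro _ ⟨x, rfl⟩
    obtain ⟨a, ha, b, hb, rfl⟩ := exists_eq_add_mul_of_adjoin_eq_top hn hrel x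
    have heq : (a + n * b) * σ (a + n * b) = a * a + s * (a * b) - s * (b * b) := by
      rw [map_add, map_mul, hfix a ha, hfix b hb]
      linear_combination b * b * hnorm - a * b * hs
    change (a + n * b) * σ (a + n * b) ∈ Algebra.adjoin k {s}
    rw [heq]
    exact sub_mem (add_mem (mul_mem ha ha) (mul_mem hsS (mul_mem ha hb)))
      (mul_mem hsS (mul_mem hb hb))
  · intro x hx
    obtain ⟨p, rfl⟩ : ∃ p : Polynomial k, Polynomial.aeval s p = x := by
      simpa [Algebra.adjoin_singleton_eq_range_aeval] using hx
    rw [Polynomial.aeval_eq_sum_range]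
    refine Submodule.sum_mem _ fun j _ => Submodule.smul_mem _ _ ?_
    have hj : s ^ j = (-1 : k) ^ j • (n ^ j * σ (n ^ j)) := by
      rw [map_pow, ← mul_pow, hnorm, neg_pow s, Algebra.smul_def]
      simp [← mul_pow]
    rw [hj]
    exact Submodule.smul_mem _ _ (Submodule.subset_span ⟨_, rfl⟩)

theorem finrank_normSpan {i : ℕ} (hσ : ∀ x, σ (σ x) = x) (hn : Algebra.adjoin k {n} = ⊤)
    (hrel : (1 + n) * (1 + σ n) = 1) (hi : ∀ j, n ^ j = 0 ↔ i ≤ j) :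
    Module.finrank k (normSpan σ) = (i + 1) / 2 := by
  rw [normSpan_eq_adjoin hσ hn hrel]
  refine finrank_adjoin_singleton_of_pow_eq_zero_iff fun j => ?_
  have hunit : IsUnit ((1 + n) ^ j) := (IsUnit.of_mul_eq_one _ hrel).pow j
  have hsq : n ^ (2 * j) = (n + σ n) ^ j * (1 + n) ^ j := by
    rw [pow_mul, ← mul_pow]
    congr 1
    linear_combination -hrel
  rw [← hunit.mul_left_eq_zero, ← hsq, hi]
  lia

/-- A bilinear map invariant under `1 + n` is balanced with respect to `σ`. -/
theorem map_mul_involution_eq {Q : Type*} [AddCommGroup Q] [Module k Q]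
    (hn : Algebra.adjoin k {n} = ⊤) (hrel : (1 + n) * (1 + σ n) = 1) (β : A →ₗ[k] A →ₗ[k] Q)
    (hβ : ∀ x y, β ((1 + n) * x) ((1 + n) * y) = β x y) (x y z : A) :
    β (x * σ y) z = β x (y * z) := by
  have hy : y ∈ Algebra.adjoin k {n} := hn ▸ Algebra.mem_top
  induction hy using Algebra.adjoin_induction generalizing x z with
  | mem y hy =>
    obtain rfl := Set.mem_singleton_iff.mp hy
    have h := hβ ((1 + σ y) * x) z
    rw [← mul_assoc, hrel, one_mul] at h
    simp only [add_mul, one_mul, map_add, LinearMap.add_apply] at h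
    rw [mul_comm x]
    exact (add_left_cancel h).symm
  | algebraMap r => simp [← Algebra.smul_def, mul_comm x]
  | add y y' _ _ hy hy' => simp [mul_add, add_mul, hy, hy']
  | mul y y' _ _ hy hy' =>
    rw [map_mul σ, mul_comm (σ y), ← mul_assoc, hy, hy', ← mul_assoc, mul_comm y']

end Involution

/-- Identify `V` with `A` through `e` so that `u` is multiplication by `1 + n`; then the
coinvariants of `u` on the exterior square of `V` are the quotient of `A` by the span of the
norms. -/
theorem finrank_extSq_coinvariants {k V A : Type*} [Field k] [AddCommGroup V] [Module k V]
    [CommRing A] [Algebra k A] {σ : A →ₐ[k] A} {n : A} (hn : Algebra.adjoin k {n} = ⊤)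
    (hrel : (1 + n) * (1 + σ n) = 1) (e : A ≃ₗ[k] V) (u : V →ₗ[k] V)
    (hu : ∀ a, u (e a) = e ((1 + n) * a)) :
    Module.finrank k (((V ⊗[k] V) ⧸ sqT k V) ⧸ LinearMap.range (extSqMap u - LinearMap.id)) =
      Module.finrank k (A ⧸ normSpan σ) := by
  set R := LinearMap.range (extSqMap u - LinearMap.id)
  let π : V ⊗[k] V →ₗ[k] ((V ⊗[k] V) ⧸ sqT k V) ⧸ R := R.mkQ ∘ₗ (sqT k V).mkQ
  have hπsq (x : V) : π (x ⊗ₜ x) = 0 := by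
    have : (sqT k V).mkQ (x ⊗ₜ x) = 0 :=
      (Submodule.Quotient.mk_eq_zero _).mpr (Submodule.subset_span ⟨x, rfl⟩)
    simp only [π, LinearMap.comp_apply, this, map_zero]
  have hπu (x y : V) : π (u x ⊗ₜ u y) = π (x ⊗ₜ y) :=
    (Submodule.Quotient.eq R).mpr ⟨(sqT k V).mkQ (x ⊗ₜ y), rfl⟩
  let β : A →ₗ[k] A →ₗ[k] ((V ⊗[k] V) ⧸ sqT k V) ⧸ R :=
    ((TensorProduct.mk k V V).compl₁₂ e.toLinearMap e.toLinearMap).compr₂ π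
  have hβ (x y z : A) : β (x * σ y) z = β x (y * z) := by
    refine map_mul_involution_eq hn hrel β (fun x y => ?_) x y z
    change π (e _ ⊗ₜ e _) = π (e _ ⊗ₜ e _)
    rw [← hu, ← hu, hπu]
  let μ : V ⊗[k] V →ₗ[k] A ⧸ normSpan σ := (normSpan σ).mkQ ∘ₗ
    TensorProduct.lift ((LinearMap.mul k A).compl₁₂ e.symm.toLinearMap
      (σ.toLinearMap ∘ₗ e.symm.toLinearMap))
  have hμ (x y : A) : μ (e x ⊗ₜ e y) = (normSpan σ).mkQ (x * σ y) := by simp [μ]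
  have hμsq : sqT k V ≤ LinearMap.ker μ := by
    refine Submodule.span_le.mpr ?_
    rintro _ ⟨x, rfl⟩
    obtain ⟨x, rfl⟩ := e.surjective x
    rw [SetLike.mem_coe, LinearMap.mem_ker, hμ]
    exact (Submodule.Quotient.mk_eq_zero _).mpr (Submodule.subset_span ⟨x, rfl⟩)
  have hμR : R ≤ LinearMap.ker ((sqT k V).liftQ μ hμsq) := by
    refine LinearMap.range_le_ker_iff.mpr (Submodule.linearMap_qext _ (TensorProduct.ext' ?_))
    intro x y
    obtain ⟨x, rfl⟩ := e.surjective x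
    obtain ⟨y, rfl⟩ := e.surjective y
    change (sqT k V).liftQ μ hμsq ((sqT k V).mkQ (u (e x) ⊗ₜ u (e y)) -
      (sqT k V).mkQ (e x ⊗ₜ e y)) = 0
    rw [map_sub, Submodule.mkQ_apply, Submodule.liftQ_apply, Submodule.mkQ_apply,
      Submodule.liftQ_apply, hu, hu, hμ, hμ, sub_eq_zero]
    congr 1
    simp only [map_mul, map_add, map_one]
    linear_combination (x * σ y) * hrel
  have hβS : normSpan σ ≤ LinearMap.ker (β.flip 1) := by
    refine Submodule.span_le.mpr ?_
    rintro _ ⟨x, rfl⟩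
    rw [SetLike.mem_coe, LinearMap.mem_ker, LinearMap.flip_apply, hβ, mul_one]
    exact hπsq (e x)
  refine LinearEquiv.finrank_eq (LinearEquiv.ofLinearMap (R.liftQ _ hμR) ((normSpan σ).liftQ _ hβS)
    ?_ ?_)
  · refine Submodule.linearMap_qext _ (LinearMap.ext fun x => ?_)
    change μ (e x ⊗ₜ e 1) = _
    rw [hμ, map_one, mul_one]
    rfl
  · refine Submodule.linearMap_qext _ (Submodule.linearMap_qext _ (TensorProduct.ext' ?_))
    intro x y
    obtain ⟨x, rfl⟩ := e.surjective x
    obtain ⟨y, rfl⟩ := e.surjective y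
    change (normSpan σ).liftQ _ hβS (μ (e x ⊗ₜ e y)) = β x y
    rw [hμ, Submodule.mkQ_apply, Submodule.liftQ_apply, LinearMap.flip_apply, hβ, mul_one]

open Polynomial in
/-- A vector not killed by `N ^ (i - 1)`, where `N ^ i = 0`, has annihilator `(X ^ i)`. -/
theorem X_pow_dvd_of_aeval_apply_eq_zero {k V : Type*} [Field k] [AddCommGroup V] [Module k V]
    {N : Module.End k V} {i : ℕ} (h1 : N ^ i = 0) {v : V} (hv : (N ^ (i - 1)) v ≠ 0)
    {p : k[X]} (hp : aeval N p v = 0) : X ^ i ∣ p := by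
  classical
  obtain ⟨l, hl, hassoc⟩ := (dvd_prime_pow prime_X i).mp (EuclideanDomain.gcd_dvd_right p (X ^ i))
  have hker : aeval N (EuclideanDomain.gcd p (X ^ i)) v = 0 := by
    rw [EuclideanDomain.gcd_eq_gcd_ab, mul_comm p]
    simp [hp, h1]
  have hNl : (N ^ l) v = 0 := by
    obtain ⟨c, hc⟩ := hassoc.dvd
    have := congrArg (fun q => aeval N q v) hc
    simpa [mul_comm _ c, hker] using this
  obtain rfl : l = i := by
    refine le_antisymm hl (not_lt.mp fun hlt => hv ?_)
    rw [← Nat.sub_add_cancel (Nat.le_sub_one_of_lt hlt), pow_add, Module.End.mul_apply, hNl,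
      map_zero]
  exact hassoc.dvd'.trans (EuclideanDomain.gcd_dvd_left _ _)

open Polynomial in
/-- The involution of `k[X] / (X ^ i)` sending `1 + X` to its inverse. -/
theorem exists_involution_adjoinRoot_X_pow (k : Type*) [Field k] (i : ℕ) :
    ∃ σ : AdjoinRoot (X ^ i : k[X]) →ₐ[k] AdjoinRoot (X ^ i : k[X]),
      (∀ x, σ (σ x) = x) ∧ (1 + AdjoinRoot.root _) * (1 + σ (AdjoinRoot.root _)) = 1 := by
  set n := AdjoinRoot.root (X ^ i : k[X])
  have hn : n ^ i = 0 := by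
    simpa using AdjoinRoot.eval₂_root (X ^ i : k[X])
  obtain ⟨t, ht⟩ := (IsNilpotent.isUnit_one_add ⟨i, hn⟩).exists_right_inv
  let σ : AdjoinRoot (X ^ i : k[X]) →ₐ[k] AdjoinRoot (X ^ i : k[X]) :=
    AdjoinRoot.liftAlgHom _ (Algebra.ofId k _) (t - 1) (by
      have : t - 1 = - t * n := by linear_combination ht
      rw [Polynomial.eval₂_X_pow, this, mul_pow, hn, mul_zero])
  have hσn : σ n = t - 1 := AdjoinRoot.liftAlgHom_root ..
  refine ⟨σ, fun x => ?_, by rw [hσn, add_sub_cancel, ht]⟩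
  have hσσ : σ.comp σ = AlgHom.id k _ := by
    refine AdjoinRoot.algHom_ext ?_
    change σ (σ n) = n
    have h := congrArg σ ht
    rw [map_mul, map_add, map_one, hσn, add_sub_cancel] at h
    rw [hσn, map_sub, map_one]
    linear_combination (1 + n) * h - σ t * ht
  exact DFunLike.congr_fun hσσ x

/-- Let `k` be a field of characteristic `2`, `V` a `k`-vector space of
dimension `i ≥ 1`, and `u` a unipotent endomorphism of `V` acting as a single Jordan block
of size `i` (i.e. `(u - 1)^i = 0` and `(u - 1)^(i-1) ≠ 0`).  Then the fixed space of the
induced action of `u` on the exterior square `Λ²(V)` has dimension `⌊i/2⌋`. -/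
theorem stmt0 (k V : Type*) [Field k] [CharP k 2]
    [AddCommGroup V] [Module k V] [FiniteDimensional k V]
    (i : ℕ) (hi : 1 ≤ i) (hdim : Module.finrank k V = i)
    (u : V →ₗ[k] V)
    (hu1 : (u - LinearMap.id) ^ i = 0)
    (hu2 : (u - LinearMap.id) ^ (i - 1) ≠ 0) :
    Module.finrank k (LinearMap.ker (extSqMap u - LinearMap.id)) = i / 2 := by
  obtain ⟨v, hv⟩ : ∃ v, ((u - LinearMap.id : Module.End k V) ^ (i - 1)) v ≠ 0 := by
    by_contra! h
    exact hu2 (LinearMap.ext h)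
  let f : Polynomial k := .X ^ i
  have hf : f ≠ 0 := pow_ne_zero _ Polynomial.X_ne_zero
  have : Module.Finite k (AdjoinRoot f) := (AdjoinRoot.powerBasis hf).finite
  have hA : Module.finrank k (AdjoinRoot f) = i := by
    rw [(AdjoinRoot.powerBasis hf).finrank, AdjoinRoot.powerBasis_dim, Polynomial.natDegree_X_pow]
  let n := AdjoinRoot.root f
  have hn (j : ℕ) : n ^ j = 0 ↔ i ≤ j := by
    change AdjoinRoot.root f ^ j = 0 ↔ i ≤ j
    rw [← AdjoinRoot.mk_X, ← map_pow, AdjoinRoot.mk_eq_zero]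
    exact pow_dvd_pow_iff Polynomial.X_ne_zero Polynomial.not_isUnit_X
  let φ : AdjoinRoot f →ₐ[k] Module.End k V :=
    Ideal.Quotient.liftₐ (Ideal.span {f}) (Polynomial.aeval (u - LinearMap.id)) (by
      intro a ha
      obtain ⟨c, rfl⟩ := Ideal.mem_span_singleton.mp ha
      simp [f, hu1])
  have hφ (p : Polynomial k) :
      φ (AdjoinRoot.mk f p) = Polynomial.aeval (u - LinearMap.id) p := rfl
  have hφn : φ n = u - LinearMap.id := (hφ .X).trans (Polynomial.aeval_X _)
  let e₀ : AdjoinRoot f →ₗ[k] V := LinearMap.applyₗ v ∘ₗ φ.toLinearMap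
  have he₀ : Function.Injective e₀ := by
    refine (injective_iff_map_eq_zero e₀).mpr fun a ha => ?_
    obtain ⟨p, rfl⟩ := AdjoinRoot.mk_surjective a
    exact AdjoinRoot.mk_eq_zero.mpr (X_pow_dvd_of_aeval_apply_eq_zero hu1 hv ha)
  let e := e₀.linearEquivOfInjective he₀ (hA.trans hdim.symm)
  have hu (a : AdjoinRoot f) : u (e a) = e ((1 + n) * a) := by
    change u (φ a v) = φ ((1 + n) * a) v
    simp [hφn]
  obtain ⟨σ, hσ, hrel⟩ := exists_involution_adjoinRoot_X_pow k i
  have hcoinv := finrank_extSq_coinvariants AdjoinRoot.adjoinRoot_eq_top hrel e u hu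
  have hS := finrank_normSpan hσ AdjoinRoot.adjoinRoot_eq_top hrel hn
  have hAS := Submodule.finrank_quotient_add_finrank (normSpan σ)
  have hrange := Submodule.finrank_quotient_add_finrank
    (LinearMap.range (extSqMap u - LinearMap.id))
  have hker := LinearMap.finrank_range_add_finrank_ker (extSqMap u - LinearMap.id)
  change _ = Module.finrank k (AdjoinRoot f) at hAS
  lia
end

section
/- Let s = diag(μ₁·I_{n₁}, …, μ_m·I_{n_m}) be a diagonalizable automorphism of an (ℓ+1)-dimensional vector space W over an algebraically closed field, with pairwise distinct μ_i, n₁ ≥ ⋯ ≥ n_m ≥ 1, Σn_i = ℓ+1, m ≥ 2, and det(s) = 1. Then for ℓ ≥ 4, every eigenspace of the induced action of s on Λ²(W) has dimension at most ℓ(ℓ−1)/2 + [3 divides ℓ], and for ℓ ≥ 5 equality ℓ(ℓ−1)/2 is attained only when, up to conjugation, s = diag(d,…,d,d^{−ℓ}) with d^{ℓ+1} ≠ 1 and the eigenvalue is d². -/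
open TensorProduct

open Module in
/-- If a family of eigenvectors spans, each eigenspace is spanned by the members of the family
with that eigenvalue. -/
theorem finrank_eigenspace_le_card_of_span_eq_top {k V ι : Type*} [Field k] [AddCommGroup V]
    [Module k V] (f : V →ₗ[k] V) (v : ι → V) (c : ι → k) (hv : ∀ i, f (v i) = c i • v i)
    (S : Finset ι) (hspan : Submodule.span k (v '' S) = ⊤) [DecidableEq k] (a : k) :
    finrank k (End.eigenspace f a) ≤ (S.filter fun i => c i = a).card := by
  classical
  have hle : End.eigenspace f a ≤
      Submodule.span k (((S.filter fun i => c i = a).image v : Finset V) : Set V) := by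
    intro w hw
    have hw' : w ∈ Submodule.span k (v '' S) := by rw [hspan]; trivial
    have hunion : v '' S = (((S.filter fun i => c i = a).image v : Finset V) : Set V) ∪
        (((S.filter fun i => ¬ c i = a).image v : Finset V) : Set V) := by
      rw [← Finset.coe_union, ← Finset.image_union, Finset.filter_union_filter_not_eq,
        Finset.coe_image]
    rw [hunion, Submodule.span_union] at hw'
    obtain ⟨y, hy, z, hz, rfl⟩ := Submodule.mem_sup.mp hw'
    have hya : y ∈ End.eigenspace f a := by
      refine Submodule.span_le.mpr ?_ hy
      intro t ht
      simp only [Finset.coe_image, Set.mem_image, Finset.mem_coe, Finset.mem_filter] at ht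
      obtain ⟨i, ⟨-, hi⟩, rfl⟩ := ht
      simp [hv, hi]
    have hzb : z ∈ ⨆ b, ⨆ (_ : b ≠ a), End.eigenspace f b := by
      refine Submodule.span_le.mpr ?_ hz
      intro t ht
      simp only [Finset.coe_image, Set.mem_image, Finset.mem_coe, Finset.mem_filter] at ht
      obtain ⟨i, ⟨-, hi⟩, rfl⟩ := ht
      exact Submodule.mem_iSup_of_mem (c i) (Submodule.mem_iSup_of_mem hi
        (End.mem_eigenspace_iff.mpr (hv i)))
    have hza : z ∈ End.eigenspace f a := by
      simpa using Submodule.sub_mem _ hw hya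
    have hz0 : z = 0 :=
      Submodule.disjoint_def.mp (End.eigenspaces_iSupIndep f a) z hza hzb
    simpa [hz0] using hy
  have : FiniteDimensional k
      (Submodule.span k (((S.filter fun i => c i = a).image v : Finset V) : Set V)) :=
    FiniteDimensional.span_finset k _
  exact (Submodule.finrank_mono hle).trans
    ((finrank_span_finset_le_card _).trans Finset.card_image_le)

/-- The multiplicity of an eigenvalue on the exterior square is at most the number of pairs of
eigenbasis vectors whose eigenvalues multiply to it. -/
theorem finrank_eigenspace_extSqMap_le {k W ι : Type*} [Field k] [DecidableEq k] [AddCommGroup W]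
    [Module k W] [Fintype ι] [LinearOrder ι] (b : Module.Basis ι k W) (x : ι → k) (s : W →ₗ[k] W)
    (hs : ∀ p, s (b p) = x p • b p) (a : k) :
    Module.finrank k (Module.End.eigenspace (extSqMap s) a) ≤
      ((Finset.univ.filter fun p : ι × ι => p.1 < p.2).filter
        fun p => x p.1 * x p.2 = a).card := by
  refine finrank_eigenspace_le_card_of_span_eq_top (extSqMap s)
    (fun p : ι × ι => (sqT k W).mkQ (b p.1 ⊗ₜ[k] b p.2)) (fun p => x p.1 * x p.2) ?_ _ ?_ a
  · intro p
    change (sqT k W).mkQ (TensorProduct.map s s (b p.1 ⊗ₜ[k] b p.2)) = _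
    rw [TensorProduct.map_tmul, hs, hs, TensorProduct.smul_tmul_smul, map_smul]
  · have hsq : ∀ w : W, (sqT k W).mkQ (w ⊗ₜ[k] w) = 0 := fun w => by
      rw [Submodule.mkQ_apply, Submodule.Quotient.mk_eq_zero]
      exact Submodule.subset_span ⟨w, rfl⟩
    have hanti : ∀ v w : W, (sqT k W).mkQ (v ⊗ₜ[k] w) = -(sqT k W).mkQ (w ⊗ₜ[k] v) := by
      intro v w
      have h := hsq (v + w)
      simp only [TensorProduct.add_tmul, TensorProduct.tmul_add, map_add, hsq] at h
      rw [eq_neg_iff_add_eq_zero]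
      simpa [add_comm] using h
    rw [eq_top_iff, ← Submodule.range_mkQ (sqT k W), LinearMap.range_eq_map,
      ← (b.tensorProduct b).span_eq, Submodule.map_span, Submodule.span_le]
    rintro _ ⟨_, ⟨⟨p, q⟩, rfl⟩, rfl⟩
    rw [Module.Basis.tensorProduct_apply]
    rcases lt_trichotomy p q with h | rfl | h
    · exact Submodule.subset_span ⟨(p, q), by simpa using h, rfl⟩
    · rw [hsq]
      exact Submodule.zero_mem _
    · rw [hanti]
      exact Submodule.neg_mem _ (Submodule.subset_span ⟨(q, p), by simpa using h, rfl⟩)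

/-- Double counting: a symmetric relation on increasing pairs. -/
theorem two_mul_card_filter_lt_eq_sum {ι : Type*} [Fintype ι] [LinearOrder ι] (r : ι → ι → Prop)
    [DecidableRel r] (hr : ∀ p q, r p q → r q p) :
    2 * ((Finset.univ.filter fun p : ι × ι => p.1 < p.2).filter fun p => r p.1 p.2).card =
      ∑ p, (Finset.univ.filter fun q => q ≠ p ∧ r p q).card := by
  have h1 : ((Finset.univ.filter fun p : ι × ι => p.1 < p.2).filter fun p => r p.1 p.2).card =
      ∑ p, (Finset.univ.filter fun q => p < q ∧ r p q).card := by
    simp only [Finset.filter_filter, Finset.card_filter]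
    rw [Fintype.sum_prod_type]
  have h2 : ((Finset.univ.filter fun p : ι × ι => p.1 < p.2).filter fun p => r p.1 p.2).card =
      ∑ p, (Finset.univ.filter fun q => q < p ∧ r p q).card := by
    simp only [Finset.filter_filter, Finset.card_filter]
    rw [Fintype.sum_prod_type_right]
    refine Finset.sum_congr rfl fun p _ => Finset.sum_congr rfl fun q _ => ?_
    have : r q p ↔ r p q := ⟨hr _ _, hr _ _⟩
    simp only [this]
  rw [two_mul]
  nth_rewrite 1 [h1]
  rw [h2, ← Finset.sum_add_distrib]
  refine Finset.sum_congr rfl fun p _ => ?_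
  rw [← Finset.card_union_of_disjoint]
  · congr 1
    ext q
    simp only [Finset.mem_union, Finset.mem_filter, Finset.mem_univ, true_and, ne_iff_lt_or_gt]
    tauto
  · rw [Finset.disjoint_filter]
    rintro q - ⟨h, -⟩ ⟨h', -⟩
    exact lt_asymm h h'

section PairCount

variable {k ι : Type*} [Field k] [DecidableEq k] [Fintype ι] [DecidableEq ι]

theorem sum_le_of_le_on_filter (P : ι → Prop) [DecidablePred P] (f : ι → ℕ) (a u v : ℕ)
    (ha : (Finset.univ.filter P).card = a) (hu : ∀ p, P p → f p ≤ u) (hv : ∀ p, ¬ P p → f p ≤ v) :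
    ∑ p, f p ≤ a * u + (Fintype.card ι - a) * v := by
  rw [← Finset.sum_filter_add_sum_filter_not Finset.univ P]
  have hc : (Finset.univ.filter fun p => ¬ P p).card = Fintype.card ι - a := by
    rw [← ha, Finset.filter_not, Finset.card_sdiff_of_subset (Finset.filter_subset _ _),
      Finset.card_univ]
  refine add_le_add ?_ ?_
  · rw [← ha, ← smul_eq_mul]
    exact Finset.sum_le_card_nsmul _ _ _ fun p hp => hu p (Finset.mem_filter.mp hp).2
  · rw [← hc, ← smul_eq_mul]
    exact Finset.sum_le_card_nsmul _ _ _ fun p hp => hv p (Finset.mem_filter.mp hp).2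

theorem sum_card_mul_eq_le_of_sq_eq (x : ι → k) {c e : k} (he : e ≠ 0) (hc : e * e = c) {a : ℕ}
    (ha : (Finset.univ.filter fun p => x p = e).card = a) :
    ∑ p, (Finset.univ.filter fun q => q ≠ p ∧ x p * x q = c).card ≤
      a * (a - 1) + (Fintype.card ι - a) * (Fintype.card ι - a - 1) := by
  have hcompl : (Finset.univ.filter fun p => ¬ x p = e).card = Fintype.card ι - a := by
    rw [← ha, Finset.filter_not, Finset.card_sdiff_of_subset (Finset.filter_subset _ _),
      Finset.card_univ]
  refine sum_le_of_le_on_filter (fun p => x p = e) _ a _ _ ha ?_ ?_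
  · intro p hp
    rw [← ha, ← Finset.card_erase_of_mem (a := p) (by simpa using hp)]
    refine Finset.card_le_card fun q hq => ?_
    simp only [Finset.mem_filter, Finset.mem_univ, true_and, Finset.mem_erase] at hq ⊢
    refine ⟨hq.1, mul_left_cancel₀ he ?_⟩
    rw [hc, ← hq.2, hp]
  · intro p hp
    rw [← hcompl, ← Finset.card_erase_of_mem (a := p) (by simpa using hp)]
    refine Finset.card_le_card fun q hq => ?_
    simp only [Finset.mem_filter, Finset.mem_univ, true_and, Finset.mem_erase] at hq ⊢
    refine ⟨hq.1, fun h => hp (mul_right_cancel₀ he ?_)⟩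
    rw [hc, ← hq.2, h]

theorem card_mul_eq_le (x : ι → k) (hx : ∀ p, x p ≠ 0) (c : k) {a : ℕ}
    (hmax : ∀ y, (Finset.univ.filter fun p => x p = y).card ≤ a) (p : ι) :
    (Finset.univ.filter fun q => q ≠ p ∧ x p * x q = c).card ≤ a := by
  refine le_trans (Finset.card_le_card fun q hq => ?_) (hmax ((x p)⁻¹ * c))
  simp only [Finset.mem_filter, Finset.mem_univ, true_and] at hq ⊢
  rw [← hq.2, inv_mul_cancel_left₀ (hx p)]

theorem sum_card_mul_eq_le_of_sq_ne (x : ι → k) (hx : ∀ p, x p ≠ 0) {c e : k} (hc : e * e ≠ c)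
    {a : ℕ} (ha : (Finset.univ.filter fun p => x p = e).card = a)
    (hmax : ∀ y, (Finset.univ.filter fun p => x p = y).card ≤ a) :
    ∑ p, (Finset.univ.filter fun q => q ≠ p ∧ x p * x q = c).card ≤
      a * (Fintype.card ι - a) + (Fintype.card ι - a) * a := by
  refine sum_le_of_le_on_filter (fun p => x p = e) _ a _ _ ha ?_ ?_
  · intro p hp
    have hcompl : (Finset.univ.filter fun p => ¬ x p = e).card = Fintype.card ι - a := by
      rw [← ha, Finset.filter_not, Finset.card_sdiff_of_subset (Finset.filter_subset _ _),
        Finset.card_univ]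
    rw [← hcompl]
    refine Finset.card_le_card fun q hq => ?_
    simp only [Finset.mem_filter, Finset.mem_univ, true_and] at hq ⊢
    rintro rfl
    exact hc (by rw [← hq.2, hp])
  · exact fun p _ => card_mul_eq_le x hx c hmax p

end PairCount

open Module in
/-- A diagonalizable endomorphism has an eigenbasis in which each eigenvalue occurs as often as
the dimension of its eigenspace. -/
theorem exists_eigenbasis {k W : Type*} [Field k] [AddCommGroup W] [Module k W]
    [FiniteDimensional k W] {m : ℕ} (μ : Fin m → k) (n : Fin m → ℕ) (hμ : Function.Injective μ)
    (s : W →ₗ[k] W) (heig : ∀ i, finrank k (End.eigenspace s (μ i)) = n i)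
    (hdiag : (⨆ i, End.eigenspace s (μ i)) = ⊤) :
    ∃ b : Basis (Σ i, Fin (n i)) k W, ∀ p, s (b p) = μ p.1 • b p := by
  have hint : DirectSum.IsInternal fun i => End.eigenspace s (μ i) :=
    DirectSum.isInternal_submodule_of_iSupIndep_of_iSup_eq_top
      ((End.eigenspaces_iSupIndep s).comp hμ) hdiag
  refine ⟨hint.collectedBasis fun i => finBasisOfFinrankEq k _ (heig i), fun p => ?_⟩
  exact End.mem_eigenspace_iff.mp (hint.collectedBasis_mem _ p)

theorem det_eq_prod_of_eigenbasis {k W ι : Type*} [Field k] [AddCommGroup W] [Module k W]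
    [Fintype ι] (b : Module.Basis ι k W) (x : ι → k) (s : W →ₗ[k] W)
    (hs : ∀ p, s (b p) = x p • b p) : LinearMap.det s = ∏ p, x p := by
  classical
  rw [← LinearMap.det_toMatrix b, show LinearMap.toMatrix b b s = Matrix.diagonal x from ?_,
    Matrix.det_diagonal]
  ext i j
  rw [LinearMap.toMatrix_apply, hs, map_smul, Module.Basis.repr_self, Finsupp.smul_single,
    Finsupp.single_apply, Matrix.diagonal_apply]
  by_cases h : i = j
  · simp [h]
  · simp [h, Ne.symm h]

/-- Let `s = diag(μ₁·I_{n₁}, …, μ_m·I_{n_m})` be a diagonalizable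
automorphism of an `(ℓ+1)`-dimensional space `W` over an algebraically closed field, with
pairwise distinct `μ_i`, `n₁ ≥ ⋯ ≥ n_m ≥ 1`, `Σ n_i = ℓ+1`, `m ≥ 2` and `det s = 1`.
Then for `ℓ ≥ 4` every eigenspace of `s` on `Λ²(W)` has dimension at most
`ℓ(ℓ−1)/2 + [3 ∣ ℓ]`, and for `ℓ ≥ 5` equality `ℓ(ℓ−1)/2` is attained only when, up to
conjugation, `s = diag(d,…,d,d^{−ℓ})` with `d^{ℓ+1} ≠ 1` and the eigenvalue is `d²`. -/
theorem stmt2 {k : Type*} [Field k] [IsAlgClosed k]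
    {W : Type*} [AddCommGroup W] [Module k W] [FiniteDimensional k W]
    (ℓ : ℕ) (hW : Module.finrank k W = ℓ + 1)
    (m : ℕ) (hm : 2 ≤ m) (μ : Fin m → k) (n : Fin m → ℕ)
    (hμ : Function.Injective μ) (hmono : Antitone n) (hn : ∀ i, 1 ≤ n i)
    (hsum : ∑ i, n i = ℓ + 1)
    (s : W →ₗ[k] W) (hdet : LinearMap.det s = 1)
    (heig : ∀ i, Module.finrank k (Module.End.eigenspace s (μ i)) = n i)
    (hdiag : (⨆ i, Module.End.eigenspace s (μ i)) = ⊤) :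
    (4 ≤ ℓ → ∀ μ0 : k,
      Module.finrank k (Module.End.eigenspace (extSqMap s) μ0) ≤
        ℓ * (ℓ - 1) / 2 + (if 3 ∣ ℓ then 1 else 0)) ∧
    (5 ≤ ℓ → ∀ μ0 : k,
      Module.finrank k (Module.End.eigenspace (extSqMap s) μ0) = ℓ * (ℓ - 1) / 2 →
      ∃ d : k, d ^ (ℓ + 1) ≠ 1 ∧ μ0 = d ^ 2 ∧ m = 2 ∧
        μ ⟨0, by omega⟩ = d ∧ n ⟨0, by omega⟩ = ℓ ∧
        μ ⟨1, by omega⟩ = d⁻¹ ^ ℓ ∧ n ⟨1, by omega⟩ = 1) := by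
  classical
  obtain ⟨m, rfl⟩ : ∃ m', m = m' + 2 := ⟨m - 2, by omega⟩
  obtain ⟨b, hb⟩ := exists_eigenbasis μ n hμ s heig hdiag
  have hprod : ∏ i, μ i ^ n i = 1 := by
    rw [← hdet, det_eq_prod_of_eigenbasis b _ s hb, Fintype.prod_sigma]
    simp
  have hμ0 : ∀ i, μ i ≠ 0 := fun i h => by
    rw [Finset.prod_eq_zero (Finset.mem_univ i) (by rw [h, zero_pow (by have := hn i; omega)])]
      at hprod
    exact zero_ne_one hprod
  have hcard : Fintype.card (Σ i, Fin (n i)) = ℓ + 1 := by simp [hsum]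
  let φ := Fintype.equivFinOfCardEq hcard
  let x : Fin (ℓ + 1) → k := fun p => μ (φ.symm p).1
  have hx : ∀ p, x p ≠ 0 := fun p => hμ0 _
  have hmult : ∀ i, (Finset.univ.filter fun p => x p = μ i).card = n i := by
    intro i
    have : (Finset.univ.filter fun p => x p = μ i) =
        (Finset.univ : Finset (Fin (n i))).map
          ((Function.Embedding.sigmaMk i).trans φ.toEmbedding) := by
      ext p
      simp only [Finset.mem_filter, Finset.mem_univ, true_and, Finset.mem_map, x]
      constructor
      · intro h
        have h' := hμ h
        obtain ⟨⟨j, t⟩, rfl⟩ := φ.surjective p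
        simp only [Equiv.symm_apply_apply] at h'
        subst h'
        exact ⟨t, rfl⟩
      · rintro ⟨t, rfl⟩
        simp
    rw [this, Finset.card_map, Finset.card_univ, Fintype.card_fin]
  have hmax : ∀ y, (Finset.univ.filter fun p => x p = y).card ≤ n 0 := by
    intro y
    by_cases hy : ∃ i, μ i = y
    · obtain ⟨i, rfl⟩ := hy
      rw [hmult]
      exact hmono (Fin.zero_le i)
    · rw [Finset.filter_false_of_mem fun p _ h => hy ⟨_, h⟩]
      simp
  have hrest : n 0 + n 1 + ∑ i : Fin m, n i.succ.succ = ℓ + 1 := by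
    rw [← hsum, Fin.sum_univ_succ, Fin.sum_univ_succ, ← add_assoc]
    rfl
  have h0 := hn 0
  have h1 := hn 1
  have hkey : ∀ c : k, 2 * Module.finrank k (Module.End.eigenspace (extSqMap s) c) ≤
      ∑ p, (Finset.univ.filter fun q => q ≠ p ∧ x p * x q = c).card := by
    intro c
    rw [← two_mul_card_filter_lt_eq_sum (fun p q => x p * x q = c)
      fun p q h => by rw [mul_comm, h]]
    refine Nat.mul_le_mul_left 2 (finrank_eigenspace_extSqMap_le (b.reindex φ) x s ?_ c)
    intro p
    simp [x, hb]
  obtain ⟨r, hr⟩ : ∃ r, ℓ = n 0 + r := ⟨ℓ - n 0, by omega⟩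
  have hsub : ℓ + 1 - n 0 = r + 1 := by omega
  obtain ⟨a, ha⟩ : ∃ a, n 0 = a + 1 := ⟨n 0 - 1, by omega⟩
  have hbound : ∀ c : k, (μ 0 * μ 0 = c →
        2 * Module.finrank k (Module.End.eigenspace (extSqMap s) c) + 2 * (a * r) ≤
          ℓ * (ℓ - 1)) ∧
      (μ 0 * μ 0 ≠ c → 2 * Module.finrank k (Module.End.eigenspace (extSqMap s) c) ≤
        2 * ((a + 1) * (r + 1))) := by
    intro c
    constructor
    · intro hc
      have h := (hkey c).trans (sum_card_mul_eq_le_of_sq_eq x (hμ0 0) hc (hmult 0))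
      rw [Fintype.card_fin, hsub, ha] at h
      obtain rfl : ℓ = a + r + 1 := by omega
      simp only [Nat.add_sub_cancel] at h ⊢
      nlinarith
    · intro hc
      have h := (hkey c).trans (sum_card_mul_eq_le_of_sq_ne x hx hc (hmult 0) hmax)
      rw [Fintype.card_fin, hsub, ha] at h
      linarith
  have hℓ : ℓ = a + r + 1 := by omega
  have heven : 2 * (ℓ * (ℓ - 1) / 2) = ℓ * (ℓ - 1) :=
    Nat.mul_div_cancel' (Nat.even_mul_pred_self ℓ).two_dvd
  refine ⟨fun h4 c => ?_, fun h5 c hM => ?_⟩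
  · refine le_trans ?_ (Nat.le_add_right _ _)
    rw [Nat.le_div_iff_mul_le two_pos]
    by_cases hc : μ 0 * μ 0 = c
    · have := (hbound c).1 hc
      omega
    · have := (hbound c).2 hc
      obtain ⟨t, rfl⟩ : ∃ t, ℓ = t + 4 := ⟨ℓ - 4, by omega⟩
      have hsq : 4 * ((a + 1) * (r + 1)) ≤ (t + 5) * (t + 5) := by
        rw [show t + 5 = (a + 1) + (r + 1) by omega]
        nlinarith [four_mul_le_sq_add (a + 1) (r + 1)]
      rw [show t + 4 - 1 = t + 3 from rfl]
      ring_nf at this hsq ⊢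
      omega
  · by_cases hc : μ 0 * μ 0 = c
    · have h := (hbound c).1 hc
      rw [hM, heven] at h
      have har : a * r = 0 := by omega
      rcases Nat.mul_eq_zero.mp har with rfl | rfl
      · have hle := (hkey c).trans (Finset.sum_le_card_nsmul _ _ 1 fun p _ =>
          card_mul_eq_le x hx c (by simpa [ha] using hmax) p)
        rw [hM, heven, Finset.card_univ, Fintype.card_fin, smul_eq_mul, mul_one] at hle
        obtain ⟨t, rfl⟩ : ∃ t, ℓ = t + 5 := ⟨ℓ - 5, by omega⟩
        simp only [Nat.add_succ_sub_one] at hle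
        nlinarith
      · have hm0 : m ≤ ∑ i : Fin m, n i.succ.succ := by
          simpa using Finset.card_nsmul_le_sum Finset.univ
            (fun i : Fin m => n i.succ.succ) 1 fun i _ => hn _
        obtain rfl : m = 0 := by omega
        have hn0 : n 0 = ℓ := by omega
        have hn1 : n 1 = 1 := by simp at hrest; omega
        have hp : μ 0 ^ ℓ * μ 1 = 1 := by
          simpa [Fin.prod_univ_two, hn0, hn1] using hprod
        have hμ1 : μ 1 = (μ 0)⁻¹ ^ ℓ := by
          rw [inv_pow]
          exact eq_inv_of_mul_eq_one_right hp
        refine ⟨μ 0, fun hd => ?_, by rw [← hc, sq], rfl, rfl, hn0, hμ1, hn1⟩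
        have : μ 0 = μ 1 := by
          refine mul_left_cancel₀ (pow_ne_zero ℓ (hμ0 0)) ?_
          rw [hp, ← pow_succ, hd]
        exact absurd (hμ this) (by decide)
    · have h := (hbound c).2 hc
      rw [hM, heven] at h
      exfalso
      obtain ⟨t, rfl⟩ : ∃ t, ℓ = t + 5 := ⟨ℓ - 5, by omega⟩
      have hsq : 4 * ((a + 1) * (r + 1)) ≤ (t + 6) * (t + 6) := by
        rw [show t + 6 = (a + 1) + (r + 1) by omega]
        nlinarith [four_mul_le_sq_add (a + 1) (r + 1)]
      rw [show t + 5 - 1 = t + 4 from rfl] at h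
      nlinarith
end
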